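/- arXiv:2101.03037 — 2 statements merged into one kernel-verified Lean document; each statement's English description precedes it below -/
import Mathlib

section
/- Let |Ψₖ⟩ = (|0ₖ⟩ + (−i)^k |1ₖ⟩) ⊗ |0_{n−k}⟩ / √2 for k = 0, …, n (with |Ψ₀⟩ = |0ₙ⟩ and |Ψₙ⟩ equal, up to phase, to the GHZ state for n ≡ 0 mod 4), and let Dₖ = D_{EM}(|Ψₖ⟩⟨Ψₖ|, |GHZₙ⟩⟨GHZₙ|). Then n/2 ≤ D₀ ≤ (n+1)/2, Dₙ = 0, and (n−k)/2 ≤ Dₖ ≤ (n−k+√2)/2 for k = 1, …, n−1. In particular D_{k+2} < Dₖ for all k = 0, …, n−2. -/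
open scoped BigOperators ComplexOrder

/-- Matrices acting on `n` qubits. -/
abbrev QMat (n : ℕ) := Matrix (Fin n → Fin 2) (Fin n → Fin 2) ℂ

/-- The trace norm (sum of the absolute values of the eigenvalues) of a Hermitian matrix. -/
noncomputable def traceNorm {n : ℕ} (X : QMat n) : ℝ :=
  if h : X.IsHermitian then ∑ i, |h.eigenvalues i| else 0

/-- The partial trace of `X` over qubit `i` vanishes. -/
def ptraceZero {n : ℕ} (i : Fin n) (X : QMat n) : Prop :=
  ∀ a b : Fin n → Fin 2,
    ∑ v : Fin 2, X (Function.update a i v) (Function.update b i v) = 0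

/-- The quantum Wasserstein-1 (earth mover's) norm, primal formulation:
`‖X‖_EM = (1/2) min { Σᵢ ‖Xᵢ‖₁ : Xᵢ Hermitian, Trᵢ Xᵢ = 0, Σᵢ Xᵢ = X }`. -/
noncomputable def emNorm {n : ℕ} (X : QMat n) : ℝ :=
  (1 / 2) * sInf { r | ∃ Xs : Fin n → QMat n,
    (∀ i, (Xs i).IsHermitian) ∧ (∀ i, ptraceZero i (Xs i)) ∧
    (∑ i, Xs i) = X ∧ r = ∑ i, traceNorm (Xs i) }

/-- The quantum Wasserstein-1 (earth mover's) distance. -/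
noncomputable def emDist {n : ℕ} (ρ σ : QMat n) : ℝ := emNorm (ρ - σ)

/-- A density matrix: positive semidefinite with unit trace. -/
def IsState {n : ℕ} (ρ : QMat n) : Prop := ρ.PosSemidef ∧ ρ.trace = 1

/-- The computational basis label with ones on the first `k` qubits and zeros elsewhere. -/
def onesUpTo (n k : ℕ) : Fin n → Fin 2 := fun j => if (j : ℕ) < k then 1 else 0

/-- Amplitudes of the GHZ state `(|0ₙ⟩ + |1ₙ⟩)/√2`. -/
noncomputable def ghzVec (n : ℕ) : (Fin n → Fin 2) → ℂ := fun u =>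
  if u = onesUpTo n 0 ∨ u = onesUpTo n n then ((Real.sqrt 2)⁻¹ : ℂ) else 0

/-- Amplitudes of `|Ψₖ⟩ = (|0ₖ⟩ + (−i)^k |1ₖ⟩) ⊗ |0_{n−k}⟩ / √2` (with `|Ψ₀⟩ = |0ₙ⟩`). -/
noncomputable def psiVec (n k : ℕ) : (Fin n → Fin 2) → ℂ := fun u =>
  if k = 0 then (if u = onesUpTo n 0 then 1 else 0)
  else if u = onesUpTo n 0 then ((Real.sqrt 2)⁻¹ : ℂ)
  else if u = onesUpTo n k then (-Complex.I) ^ k * ((Real.sqrt 2)⁻¹ : ℂ)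
  else 0

/-- The density matrix `|v⟩⟨v|` of a pure state with amplitudes `v`. -/
noncomputable def outer {n : ℕ} (v : (Fin n → Fin 2) → ℂ) : QMat n :=
  Matrix.vecMulVec v (star v)


def TB {n : ℕ} (X : QMat n) (r : ℝ) : Prop :=
  ∀ e : OrthonormalBasis (Fin n → Fin 2) ℂ (EuclideanSpace ℂ (Fin n → Fin 2)),
    ∑ j, ‖star (e j).ofLp ⬝ᵥ X.mulVec (e j).ofLp‖ ≤ r

lemma TB.add {n : ℕ} {X Y : QMat n} {r s : ℝ} (hX : TB X r) (hY : TB Y s) : TB (X + Y) (r + s) := by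
  intro e
  refine le_trans ?_ (add_le_add (hX e) (hY e))
  rw [← Finset.sum_add_distrib]
  refine Finset.sum_le_sum fun j _ => ?_
  rw [Matrix.add_mulVec, dotProduct_add]
  exact norm_add_le _ _

lemma TB.smul {n : ℕ} {X : QMat n} {r : ℝ} (c : ℂ) (hX : TB X r) : TB (c • X) (‖c‖ * r) := by
  intro e
  refine le_trans ?_ (mul_le_mul_of_nonneg_left (hX e) (norm_nonneg c))
  rw [Finset.mul_sum]
  refine Finset.sum_le_sum fun j _ => ?_
  rw [Matrix.smul_mulVec, dotProduct_smul, norm_smul]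

lemma TB.zero {n : ℕ} : TB (0 : QMat n) 0 := by
  intro e; simp

lemma TB.mk {n : ℕ} (a b : (Fin n → Fin 2) → ℂ) (ha : ∑ u, ‖a u‖ ^ 2 = 1)
    (hb : ∑ u, ‖b u‖ ^ 2 = 1) : TB (Matrix.vecMulVec a (star b)) 1 := by
  intro e
  have h1 := e.sum_sq_norm_inner_right (WithLp.toLp 2 a)
  have h2 := e.sum_sq_norm_inner_left (WithLp.toLp 2 b)
  rw [EuclideanSpace.norm_sq_eq] at h1 h2
  simp only [ha, hb] at h1 h2
  have : ∀ j, ‖star (e j).ofLp ⬝ᵥ (Matrix.vecMulVec a (star b)).mulVec (e j).ofLp‖ ≤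
      (‖inner ℂ (e j) (WithLp.toLp 2 a)‖ ^ 2 + ‖inner ℂ (WithLp.toLp 2 b) (e j)‖ ^ 2) / 2 := by
    intro j
    rw [Matrix.vecMulVec_mulVec, dotProduct_smul, EuclideanSpace.inner_eq_star_dotProduct,
      EuclideanSpace.inner_eq_star_dotProduct, op_smul_eq_mul, norm_mul,
      dotProduct_comm (star b), dotProduct_comm a]
    nlinarith [sq_nonneg (‖star (e j).ofLp ⬝ᵥ a‖ - ‖(e j).ofLp ⬝ᵥ star b‖)]
  refine (Finset.sum_le_sum fun j _ => this j).trans ?_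
  rw [← Finset.sum_div, Finset.sum_add_distrib, h1, h2]
  norm_num

lemma traceNorm_le {n : ℕ} {X : QMat n} {r : ℝ} (hX : X.IsHermitian) (h : TB X r) :
    traceNorm X ≤ r := by
  unfold traceNorm
  rw [dif_pos hX]
  refine le_trans (Finset.sum_le_sum fun j _ => ?_) (h hX.eigenvectorBasis)
  rw [hX.eigenvalues_eq]
  exact Complex.abs_re_le_norm _

lemma traceNorm_nonneg {n : ℕ} (X : QMat n) : 0 ≤ traceNorm X := by
  unfold traceNorm
  split_ifs
  · positivity
  · exact le_rfl

lemma le_traceNorm {n : ℕ} {X : QMat n} (hX : X.IsHermitian) (s : (Fin n → Fin 2) → ℂ)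
    (hs : ∀ u, ‖s u‖ ≤ 1) : ‖∑ u, s u * X u u‖ ≤ traceNorm X := by
  unfold traceNorm
  rw [dif_pos hX]
  have hd : ∀ u, X u u = ∑ j, (hX.eigenvalues j : ℂ) *
      ((hX.eigenvectorBasis j).ofLp u * star ((hX.eigenvectorBasis j).ofLp u)) := by
    intro u
    conv_lhs => rw [hX.spectral_theorem, Unitary.conjStarAlgAut_apply]
    rw [Matrix.mul_apply]
    refine Finset.sum_congr rfl fun j _ => ?_
    rw [Matrix.mul_diagonal, Matrix.star_apply, hX.eigenvectorUnitary_apply]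
    simp only [Function.comp_apply, Complex.coe_algebraMap]
    ring
  have h1 : ∀ u, ‖s u * X u u‖ ≤ ∑ j, |hX.eigenvalues j| * ‖(hX.eigenvectorBasis j).ofLp u‖ ^ 2 := by
    intro u
    rw [norm_mul]
    refine (mul_le_of_le_one_left (norm_nonneg _) (hs u)).trans ?_
    rw [hd u]
    refine (norm_sum_le _ _).trans (le_of_eq ?_)
    refine Finset.sum_congr rfl fun j _ => ?_
    rw [norm_mul, norm_mul, norm_star, sq, Complex.norm_real, Real.norm_eq_abs]
  refine (norm_sum_le _ _).trans ((Finset.sum_le_sum fun u _ => h1 u).trans ?_)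
  rw [Finset.sum_comm]
  refine Finset.sum_le_sum fun j _ => ?_
  rw [← Finset.mul_sum, ← EuclideanSpace.norm_sq_eq, hX.eigenvectorBasis.orthonormal.1 j]
  simp

def sgn2 (v : Fin 2) : ℂ := if v = 0 then 1 else -1

lemma ptrace_sum {n : ℕ} {X : QMat n} {i j : Fin n} (h : ptraceZero i X) (hij : j ≠ i) :
    ∑ u, sgn2 (u j) * X u u = 0 := by
  refine Finset.sum_involution (fun u _ => Function.update u i (1 - u i)) ?_ ?_ ?_ ?_
  · intro u _
    have := h u u
    rw [Fin.sum_univ_two] at this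
    rw [Function.update_of_ne hij, ← mul_add]
    have hu : Function.update u i (u i) = u := Function.update_eq_self _ _
    rcases (show u i = 0 ∨ u i = 1 by omega) with h0 | h0
    · rw [h0] at hu ⊢
      rw [hu] at this
      rw [show (1 - 0 : Fin 2) = 1 from rfl, this, mul_zero]
    · rw [h0] at hu ⊢
      rw [hu] at this
      rw [show (1 - 1 : Fin 2) = 0 from rfl, add_comm, this, mul_zero]
  · intro u _ _ h2
    have := congrFun h2 i
    rw [Function.update_self] at this
    omega
  · simp
  · intro u _
    simp

lemma emDist_lower {n k : ℕ} (hk : k ≤ n) (A B : QMat n) (hne : ∃ Xs : Fin n → QMat n,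
    (∀ i, (Xs i).IsHermitian) ∧ (∀ i, ptraceZero i (Xs i)) ∧ (∑ i, Xs i) = A - B)
    (h : ∀ j : Fin n, k ≤ (j : ℕ) → ∑ u, sgn2 (u j) * (A - B) u u = 1) :
    ((n : ℝ) - k) / 2 ≤ emDist A B := by
  unfold emDist emNorm
  suffices (n : ℝ) - k ≤ sInf { r | ∃ Xs : Fin n → QMat n,
    (∀ i, (Xs i).IsHermitian) ∧ (∀ i, ptraceZero i (Xs i)) ∧
    (∑ i, Xs i) = A - B ∧ r = ∑ i, traceNorm (Xs i) } by linarith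
  apply le_csInf
  · obtain ⟨Xs, h1, h2, h3⟩ := hne
    exact ⟨_, Xs, h1, h2, h3, rfl⟩
  rintro r ⟨Xs, h1, h2, h3, rfl⟩
  have key : ∀ j : Fin n, (if k ≤ (j : ℕ) then (1 : ℝ) else 0) ≤ traceNorm (Xs j) := by
    intro j
    split_ifs with hj
    · have h4 := h j hj
      rw [← h3] at h4
      have h5 : ∑ u, sgn2 (u j) * (∑ i, Xs i) u u = ∑ u, sgn2 (u j) * Xs j u u := by
        simp_rw [Matrix.sum_apply, Finset.mul_sum]
        rw [Finset.sum_comm]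
        rw [Finset.sum_eq_single j]
        · intro i _ hi
          exact ptrace_sum (h2 i) hi.symm
        · simp
      rw [h5] at h4
      have := le_traceNorm (h1 j) (fun u => sgn2 (u j)) (by
        intro u; unfold sgn2; split_ifs <;> simp)
      rw [h4] at this
      simpa using this
    · exact traceNorm_nonneg _
  refine le_trans (le_of_eq ?_) (Finset.sum_le_sum fun j _ => key j)
  rw [Fin.sum_univ_eq_sum_range (fun j => if k ≤ j then (1 : ℝ) else 0), ← Finset.sum_filter]
  have : (Finset.range n).filter (fun j => k ≤ j) = Finset.Ico k n := by
    ext; simp; omega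
  rw [this]
  simp [Nat.cast_sub hk]

lemma emDist_le {n : ℕ} (A B : QMat n) (Xs : Fin n → QMat n)
    (h1 : ∀ i, (Xs i).IsHermitian) (h2 : ∀ i, ptraceZero i (Xs i)) (h3 : (∑ i, Xs i) = A - B)
    (r : Fin n → ℝ) (h4 : ∀ i, TB (Xs i) (r i)) : emDist A B ≤ (∑ i, r i) / 2 := by
  unfold emDist emNorm
  suffices sInf { r | ∃ Xs : Fin n → QMat n,
    (∀ i, (Xs i).IsHermitian) ∧ (∀ i, ptraceZero i (Xs i)) ∧
    (∑ i, Xs i) = A - B ∧ r = ∑ i, traceNorm (Xs i) } ≤ ∑ i, r i by linarith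
  have hm : (∑ i, traceNorm (Xs i)) ∈ { r | ∃ Xs : Fin n → QMat n,
    (∀ i, (Xs i).IsHermitian) ∧ (∀ i, ptraceZero i (Xs i)) ∧
    (∑ i, Xs i) = A - B ∧ r = ∑ i, traceNorm (Xs i) } := ⟨Xs, h1, h2, h3, rfl⟩
  refine (csInf_le ⟨0, ?_⟩ hm).trans
    (Finset.sum_le_sum fun i _ => traceNorm_le (h1 i) (h4 i))
  rintro r ⟨Xs, h1, h2, h3, rfl⟩
  exact Finset.sum_nonneg fun i _ => traceNorm_nonneg _


lemma emDist_nonneg {n : ℕ} (A B : QMat n) : 0 ≤ emDist A B := by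
  unfold emDist emNorm
  refine mul_nonneg (by norm_num) (Real.sInf_nonneg ?_)
  rintro r ⟨Xs, h1, h2, h3, rfl⟩
  exact Finset.sum_nonneg fun i _ => traceNorm_nonneg _

lemma ptraceZero.add {n : ℕ} {i : Fin n} {X Y : QMat n} (hX : ptraceZero i X)
    (hY : ptraceZero i Y) : ptraceZero i (X + Y) := by
  intro a b
  simp only [Matrix.add_apply, Finset.sum_add_distrib, hX a b, hY a b, add_zero]

lemma ptraceZero.smul {n : ℕ} {i : Fin n} {X : QMat n} (c : ℂ) (hX : ptraceZero i X) :
    ptraceZero i (c • X) := by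
  intro a b
  simp only [Matrix.smul_apply, ← Finset.smul_sum, hX a b, smul_zero]

lemma ptraceZero.zero {n : ℕ} {i : Fin n} : ptraceZero i (0 : QMat n) := by
  intro a b
  simp

noncomputable def ket (n m : ℕ) : (Fin n → Fin 2) → ℂ := Pi.single (onesUpTo n m) 1

noncomputable def EE (n m l : ℕ) : QMat n := Matrix.vecMulVec (ket n m) (star (ket n l))

lemma EE_apply (n m l : ℕ) (x y : Fin n → Fin 2) :
    EE n m l x y = if x = onesUpTo n m ∧ y = onesUpTo n l then 1 else 0 := by
  unfold EE ket
  rw [Matrix.vecMulVec_apply, Pi.star_apply, Pi.single_apply, Pi.single_apply]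
  split_ifs <;> simp_all

lemma EE_herm (n m l : ℕ) : (EE n m l).conjTranspose = EE n l m := by
  unfold EE
  rw [Matrix.conjTranspose_vecMulVec, star_star]

lemma ket_norm (n m : ℕ) : ∑ u, ‖ket n m u‖ ^ 2 = 1 := by
  unfold ket
  rw [Finset.sum_eq_single (onesUpTo n m)]
  · simp
  · intro b _ hb
    simp [Pi.single_apply, hb]
  · simp

lemma TB_EE (n m l : ℕ) : TB (EE n m l) 1 := TB.mk _ _ (ket_norm n m) (ket_norm n l)

lemma ones_ne {n m l : ℕ} (h : m < l) (hl : l ≤ n) : onesUpTo n m ≠ onesUpTo n l := by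
  intro he
  have := congrFun he ⟨m, by omega⟩
  simp [onesUpTo, h] at this

lemma ptrace_off {n : ℕ} (hn : 0 < n) (l : ℕ) (hl : 0 < l) :
    ptraceZero ⟨0, hn⟩ (EE n 0 l) ∧ ptraceZero ⟨0, hn⟩ (EE n l 0) := by
  have key : ∀ (a b : Fin n → Fin 2) v, ¬ (Function.update a ⟨0, hn⟩ v = onesUpTo n 0 ∧
      Function.update b ⟨0, hn⟩ v = onesUpTo n l) := by
    rintro a b v ⟨h1, h2⟩
    have h1 := congrFun h1 ⟨0, hn⟩
    have h2 := congrFun h2 ⟨0, hn⟩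
    simp [onesUpTo, hl] at h1 h2
    omega
  constructor
  · intro a b
    refine Finset.sum_eq_zero fun v _ => ?_
    rw [EE_apply, if_neg (key a b v)]
  · intro a b
    refine Finset.sum_eq_zero fun v _ => ?_
    rw [EE_apply, if_neg (fun h => key b a v h.symm)]

noncomputable def TT (n i : ℕ) : QMat n := (1 / 2 : ℂ) • EE n i i + (-1 / 2 : ℂ) • EE n (i+1) (i+1)

lemma ptrace_TT {n : ℕ} (i : Fin n) : ptraceZero i (TT n i) := by
  intro a b
  have k1 : ∀ a : Fin n → Fin 2, Function.update a i 0 ≠ onesUpTo n (i+1) := by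
    intro a h
    have := congrFun h i
    simp [onesUpTo] at this
  have k2 : ∀ a : Fin n → Fin 2, Function.update a i 1 ≠ onesUpTo n i := by
    intro a h
    have := congrFun h i
    simp [onesUpTo] at this
  have k3 : ∀ a : Fin n → Fin 2, Function.update a i 1 = onesUpTo n (i+1) ↔
      Function.update a i 0 = onesUpTo n i := by
    intro a
    rw [funext_iff, funext_iff]
    refine forall_congr' fun x => ?_
    by_cases hx : x = i
    · subst hx; simp [onesUpTo]
    · have hx' : (x : ℕ) ≠ i := fun h => hx (Fin.ext h)
      have : (x : ℕ) < i + 1 ↔ (x : ℕ) < i := by omega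
      simp [onesUpTo, hx, this]
  rw [Fin.sum_univ_two]
  simp only [TT, Matrix.add_apply, Matrix.smul_apply, EE_apply, k1, k2, k3]
  split_ifs <;> simp_all
  norm_num

lemma TB_TT (n i : ℕ) : TB (TT n i) 1 := by
  have := ((TB_EE n i i).smul (1/2)).add ((TB_EE n (i+1) (i+1)).smul (-1/2))
  unfold TT
  convert this using 1
  norm_num

lemma TT_herm (n i : ℕ) : (TT n i).IsHermitian := by
  unfold TT Matrix.IsHermitian
  rw [Matrix.conjTranspose_add, Matrix.conjTranspose_smul, Matrix.conjTranspose_smul, EE_herm,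
    EE_herm]
  simp

lemma main_bounds {n k : ℕ} (hn : 0 < n) (hk : k ≤ n) (A B Y : QMat n) (y : ℝ)
    (hAB : A - B = ((1 / 2 : ℂ) • EE n k k + (-1 / 2 : ℂ) • EE n n n) + Y)
    (hY : Y.IsHermitian) (hp : ptraceZero ⟨0, hn⟩ Y) (hT : TB Y y) (hd : ∀ u, Y u u = 0) :
    ((n : ℝ) - k) / 2 ≤ emDist A B ∧ emDist A B ≤ ((n : ℝ) - k + y) / 2 := by
  let Xs : Fin n → QMat n := fun i =>
    (if k ≤ (i : ℕ) then TT n i else 0) + (if i = ⟨0, hn⟩ then Y else 0)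
  have h1 : ∀ i, (Xs i).IsHermitian := by
    intro i
    refine Matrix.IsHermitian.add ?_ ?_
    · split_ifs
      · exact TT_herm n i
      · exact Matrix.isHermitian_zero
    · split_ifs
      · exact hY
      · exact Matrix.isHermitian_zero
  have h2 : ∀ i, ptraceZero i (Xs i) := by
    intro i
    refine ptraceZero.add ?_ ?_
    · split_ifs
      · exact ptrace_TT i
      · exact ptraceZero.zero
    · split_ifs with h
      · subst h; exact hp
      · exact ptraceZero.zero
  have hf : (Finset.range n).filter (fun j => k ≤ j) = Finset.Ico k n := by
    ext; simp; omega
  have h3 : (∑ i, Xs i) = A - B := by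
    simp only [Xs]
    rw [Finset.sum_add_distrib, hAB]
    congr 1
    · rw [Fin.sum_univ_eq_sum_range (fun j => if k ≤ j then TT n j else 0), ← Finset.sum_filter, hf]
      have := Finset.sum_Ico_sub (fun j => (-1 / 2 : ℂ) • EE n j j) hk
      rw [show ((1 / 2 : ℂ) • EE n k k + (-1 / 2 : ℂ) • EE n n n) =
        (-1 / 2 : ℂ) • EE n n n - (-1 / 2 : ℂ) • EE n k k by module, ← this]
      refine Finset.sum_congr rfl fun j _ => ?_
      unfold TT
      module
    · simp
  have h4 : ∀ i, TB (Xs i) ((if k ≤ (i : ℕ) then 1 else 0) + (if i = ⟨0, hn⟩ then y else 0)) := by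
    intro i
    refine TB.add ?_ ?_
    · split_ifs
      · exact TB_TT n i
      · exact TB.zero
    · split_ifs
      · exact hT
      · exact TB.zero
  constructor
  · refine emDist_lower hk A B ⟨Xs, h1, h2, h3⟩ ?_
    intro j hj
    rw [hAB]
    simp only [Matrix.add_apply, Matrix.smul_apply, hd, EE_apply, and_self, smul_eq_mul, mul_add,
      Finset.sum_add_distrib, add_zero, mul_ite, mul_one, mul_zero, Finset.sum_ite_eq',
      Finset.mem_univ, if_true]
    simp [sgn2, onesUpTo, hj]
    norm_num
  · refine (emDist_le A B Xs h1 h2 h3 _ h4).trans (le_of_eq ?_)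
    rw [Finset.sum_add_distrib]
    rw [Fin.sum_univ_eq_sum_range (fun j => if k ≤ j then (1 : ℝ) else 0), ← Finset.sum_filter, hf]
    simp [Nat.cast_sub hk]


lemma ones_diag {n m l : ℕ} (h : onesUpTo n m ≠ onesUpTo n l) (u : Fin n → Fin 2) :
    EE n m l u u = 0 := by
  rw [EE_apply, if_neg]
  rintro ⟨h1, h2⟩
  exact h (h1.symm.trans h2)

lemma sqrt2_inv_sq : ((Real.sqrt 2 : ℂ)⁻¹) * ((Real.sqrt 2 : ℂ)⁻¹) = 1 / 2 := by
  rw [← mul_inv, ← Complex.ofReal_mul, Real.mul_self_sqrt (by norm_num)]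
  norm_num

lemma ghz_eq {n : ℕ} (hn : 0 < n) : ghzVec n = (Real.sqrt 2 : ℂ)⁻¹ • (ket n 0 + ket n n) := by
  have := ones_ne hn le_rfl
  ext u
  simp only [ghzVec, ket, Pi.smul_apply, Pi.add_apply, Pi.single_apply]
  split_ifs <;> simp_all

lemma psi_eq {n k : ℕ} (hk0 : 0 < k) (hk : k ≤ n) :
    psiVec n k = (Real.sqrt 2 : ℂ)⁻¹ • (ket n 0 + (-Complex.I) ^ k • ket n k) := by
  have := ones_ne hk0 hk
  ext u
  simp only [psiVec, ket, Pi.smul_apply, Pi.add_apply, Pi.single_apply]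
  split_ifs <;> simp_all [mul_comm]

lemma psi0_eq (n : ℕ) : psiVec n 0 = ket n 0 := by
  ext u
  simp [psiVec, ket, Pi.single_apply]

lemma outer_comb (n m : ℕ) (c : ℂ) (hc : c * star c = 1) :
    outer ((Real.sqrt 2 : ℂ)⁻¹ • (ket n 0 + c • ket n m)) =
      (1 / 2 : ℂ) • EE n 0 0 + (1 / 2 : ℂ) • EE n m m + (star c / 2) • EE n 0 m
        + (c / 2) • EE n m 0 := by
  have hs : star ((Real.sqrt 2 : ℂ)⁻¹) = (Real.sqrt 2 : ℂ)⁻¹ := by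
    simp
  have h2 := sqrt2_inv_sq
  unfold outer EE
  ext x y
  simp only [Matrix.vecMulVec_apply, Matrix.add_apply, Matrix.smul_apply, Pi.smul_apply,
    Pi.add_apply, Pi.star_apply, star_mul', star_add, smul_eq_mul, hs]
  linear_combination ((ket n 0 x + c * ket n m x) *
    (star (ket n 0 y) + star c * star (ket n m y))) * h2 + (1/2) * ket n m x * star (ket n m y) * hc

lemma phase (k : ℕ) : ((-Complex.I) ^ k) * star ((-Complex.I) ^ k) = 1 := by
  rw [star_pow, ← mul_pow]
  simp

lemma decomp0 {n : ℕ} (hn : 0 < n) :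
    ((n : ℝ)) / 2 ≤ emDist (outer (psiVec n 0)) (outer (ghzVec n)) ∧
    emDist (outer (psiVec n 0)) (outer (ghzVec n)) ≤ ((n : ℝ) + 1) / 2 := by
  have hne := ones_ne hn (le_refl n)
  have hg := outer_comb n n 1 (by simp)
  rw [one_smul, ← ghz_eq hn] at hg
  have := main_bounds (k := 0) hn (Nat.zero_le n) (outer (psiVec n 0)) (outer (ghzVec n))
    ((-1/2 : ℂ) • EE n 0 n + (-1/2 : ℂ) • EE n n 0) 1 ?_ ?_ ?_ ?_ ?_
  · simpa using this
  · rw [hg, psi0_eq]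
    change EE n 0 0 - _ = _
    rw [star_one]
    module
  · unfold Matrix.IsHermitian
    rw [Matrix.conjTranspose_add, Matrix.conjTranspose_smul, Matrix.conjTranspose_smul, EE_herm,
      EE_herm, add_comm]
    simp
  · exact ((ptrace_off hn n hn).1.smul _).add ((ptrace_off hn n hn).2.smul _)
  · have := ((TB_EE n 0 n).smul (-1/2)).add ((TB_EE n n 0).smul (-1/2))
    convert this using 1
    norm_num
  · intro u
    simp [ones_diag hne, ones_diag hne.symm]

lemma decompk {n k : ℕ} (hk0 : 0 < k) (hk : k < n) :
    ((n : ℝ) - k) / 2 ≤ emDist (outer (psiVec n k)) (outer (ghzVec n)) ∧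
    emDist (outer (psiVec n k)) (outer (ghzVec n)) ≤ ((n : ℝ) - k + Real.sqrt 2) / 2 := by
  have hn : 0 < n := by omega
  have hne := ones_ne hn (le_refl n)
  have hne' := ones_ne hk0 hk.le
  have hnek := ones_ne hk (le_refl n)
  have hg := outer_comb n n 1 (by simp)
  rw [one_smul, ← ghz_eq hn] at hg
  have hp := outer_comb n k _ (phase k)
  rw [← psi_eq hk0 hk.le] at hp
  have hc := phase k
  have hcn : ‖(-Complex.I) ^ k‖ = 1 := by simp
  generalize (-Complex.I) ^ k = c at hp hc hcn
  have h2 := sqrt2_inv_sq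
  have hs : star ((Real.sqrt 2 : ℂ)⁻¹) = (Real.sqrt 2 : ℂ)⁻¹ := by
    simp
  refine main_bounds (k := k) hn hk.le (outer (psiVec n k)) (outer (ghzVec n))
    (((star c/2 : ℂ) • EE n 0 k + (c/2 : ℂ) • EE n k 0) +
      ((-1/2 : ℂ) • EE n 0 n + (-1/2 : ℂ) • EE n n 0)) _ ?_ ?_ ?_ ?_ ?_
  · rw [hg, hp, star_one]
    module
  · unfold Matrix.IsHermitian
    simp only [Matrix.conjTranspose_add, Matrix.conjTranspose_smul, EE_herm]
    rw [add_comm (_ • EE n k 0), add_comm (_ • EE n n 0)]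
    simp
  · exact (((ptrace_off hn k hk0).1.smul _).add ((ptrace_off hn k hk0).2.smul _)).add
      (((ptrace_off hn n hn).1.smul _).add ((ptrace_off hn n hn).2.smul _))
  · let w : (Fin n → Fin 2) → ℂ := (Real.sqrt 2 : ℂ)⁻¹ • (c • ket n k - ket n n)
    have hw : ∑ u, ‖w u‖ ^ 2 = 1 := by
      have : ∀ u, ‖w u‖ ^ 2 = (‖ket n k u‖ ^ 2 + ‖ket n n u‖ ^ 2) / 2 := by
        intro u
        have hu : ket n k u = 0 ∨ ket n n u = 0 := by
          simp only [ket, Pi.single_apply]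
          split_ifs <;> simp_all
        have e : ‖(Real.sqrt 2 : ℂ)⁻¹‖ ^ 2 = 1 / 2 := by
          rw [norm_inv, Complex.norm_real, Real.norm_eq_abs, inv_pow, sq_abs]
          norm_num
        simp only [w, Pi.smul_apply, Pi.sub_apply, smul_eq_mul, norm_mul, mul_pow, e]
        rcases hu with hu | hu <;> rw [hu] <;> simp [hcn] <;> ring
      simp_rw [this]
      rw [← Finset.sum_div, Finset.sum_add_distrib, ket_norm, ket_norm]
      norm_num
    have t := ((TB.mk _ _ (ket_norm n 0) hw).add (TB.mk _ _ hw (ket_norm n 0))).smul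
      (Real.sqrt 2 : ℂ)⁻¹
    have e1 : ‖(Real.sqrt 2 : ℂ)⁻¹‖ * (1 + 1) = Real.sqrt 2 := by
      rw [norm_inv, Complex.norm_real, Real.norm_eq_abs, abs_of_nonneg (Real.sqrt_nonneg 2)]
      have := Real.mul_self_sqrt (show (0 : ℝ) ≤ 2 by norm_num)
      field_simp
      nlinarith
    rw [e1] at t
    convert t using 1
    ext x y
    simp only [EE, w, Matrix.vecMulVec_apply, Matrix.add_apply, Matrix.smul_apply, Pi.smul_apply,
      Pi.sub_apply, Pi.star_apply, star_mul', star_sub, smul_eq_mul, hs]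
    linear_combination (-(ket n 0 x * (star c * star (ket n k y) - star (ket n n y)) +
      (c * ket n k x - ket n n x) * star (ket n 0 y))) * h2
  · intro u
    simp [ones_diag hne, ones_diag hne.symm, ones_diag hne', ones_diag hne'.symm]

/-- For `n` a positive multiple of `4` and `Dₖ = D_EM(|Ψₖ⟩⟨Ψₖ|, |GHZₙ⟩⟨GHZₙ|)`:
`n/2 ≤ D₀ ≤ (n+1)/2`, `Dₙ = 0`, `(n−k)/2 ≤ Dₖ ≤ (n−k+√2)/2` for `1 ≤ k ≤ n−1`,
and in particular `D_{k+2} < Dₖ` for all `0 ≤ k ≤ n−2`. -/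
theorem ghz_em_distance_improves (n : ℕ) (hn : 0 < n) (hn4 : 4 ∣ n)
    (D : ℕ → ℝ) (hD : ∀ k, D k = emDist (outer (psiVec n k)) (outer (ghzVec n))) :
    ((n : ℝ) / 2 ≤ D 0 ∧ D 0 ≤ ((n : ℝ) + 1) / 2) ∧
    D n = 0 ∧
    (∀ k : ℕ, 1 ≤ k → k ≤ n - 1 →
      ((n : ℝ) - k) / 2 ≤ D k ∧ D k ≤ ((n : ℝ) - k + Real.sqrt 2) / 2) ∧
    (∀ k : ℕ, k ≤ n - 2 → D (k + 2) < D k) := by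
  have h0 := decomp0 hn
  have hn4' : 4 ≤ n := Nat.le_of_dvd hn hn4
  have hDn : D n = 0 := by
    have he : outer (psiVec n n) = outer (ghzVec n) := by
      obtain ⟨m, rfl⟩ := hn4
      rw [psi_eq hn le_rfl, ghz_eq hn, pow_mul]
      have h4 : (-Complex.I) ^ 4 = 1 := by
        rw [Even.neg_pow (by decide), Complex.I_pow_four]
      rw [h4, one_pow, one_smul]
    rw [hD, he]
    refine le_antisymm ?_ (emDist_nonneg _ _)
    have := emDist_le (outer (ghzVec n)) (outer (ghzVec n)) (fun _ => 0)
      (fun _ => Matrix.isHermitian_zero) (fun _ => ptraceZero.zero) (by simp) (fun _ => 0)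
      (fun _ => TB.zero)
    simpa using this
  have hs : Real.sqrt 2 < 2 := by
    rw [Real.sqrt_lt' (by norm_num)]; norm_num
  have hk : ∀ k : ℕ, 1 ≤ k → k ≤ n - 1 →
      ((n : ℝ) - k) / 2 ≤ D k ∧ D k ≤ ((n : ℝ) - k + Real.sqrt 2) / 2 := by
    intro k h1 h2
    rw [hD]
    exact decompk h1 (by omega)
  rw [← hD 0] at h0
  refine ⟨h0, hDn, hk, ?_⟩
  intro k hkn
  have hlow : ((n : ℝ) - k) / 2 ≤ D k := by
    rcases Nat.eq_zero_or_pos k with rfl | hpos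
    · simpa using h0.1
    · exact (hk k hpos (by omega)).1
  rcases Nat.lt_or_ge (k + 2) n with h | h
  · have := (hk (k + 2) (by omega) (by omega)).2
    push_cast at this
    linarith
  · have he : k + 2 = n := by omega
    have : (n : ℝ) = k + 2 := by rw [← he]; push_cast; ring
    rw [he, hDn]
    linarith
end

section
/- (Danskin-type derivative of the EM distance.) Let σ be a fixed n-qubit state and ρ(t), 0 ≤ t ≤ T, a family of states differentiable at t = 0. Then the right derivative at t = 0 of t ↦ D_{EM}(ρ(t), σ) equals max { Tr[ρ'(0) H] : H observable, ‖H‖_L ≤ 1, Tr[(ρ(0)−σ)H] = D_{EM}(ρ(0),σ) }, i.e., the maximum of Tr[ρ'(0) H] over the optimizers H of the dual EM problem at t = 0. -/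
open scoped BigOperators ComplexOrder

/-- The operator norm (maximal absolute value of the eigenvalues) of a Hermitian matrix. -/
noncomputable def opNorm {n : ℕ} (X : QMat n) : ℝ :=
  if h : X.IsHermitian then ⨆ i, |h.eigenvalues i| else 0

/-- `H` acts as the identity on qubit `i`, i.e. `H = H̃ ⊗ I_i`. -/
def actsIdOn {n : ℕ} (i : Fin n) (H : QMat n) : Prop :=
  ∀ a b : Fin n → Fin 2,
    H a b = if a i = b i then H (Function.update a i 0) (Function.update b i 0) else 0

/-- The quantum Lipschitz constant
`‖H‖_L = 2 maxᵢ min { ‖H − H̃‖_∞ : H̃ acts as the identity on qubit i }`. -/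
noncomputable def lipConst {n : ℕ} (H : QMat n) : ℝ :=
  2 * ⨆ i : Fin n,
    sInf { r | ∃ K : QMat n, K.IsHermitian ∧ actsIdOn i K ∧ r = opNorm (H - K) }

/-- The quantum EM distance, dual formulation:
`D_EM(ρ,σ) = max { Tr[(ρ−σ)H] : H Hermitian, ‖H‖_L ≤ 1 }`. -/
noncomputable def emDistDual {n : ℕ} (ρ σ : QMat n) : ℝ :=
  sSup { r | ∃ H : QMat n, H.IsHermitian ∧ lipConst H ≤ 1 ∧ r = (((ρ - σ) * H).trace).re }

section danskinAbstract
open Filter Topology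

theorem danskin_abs {E : Type*} [NormedAddCommGroup E] [NormedSpace ℝ E]
    (K : Set E) (hK : IsCompact K) (hne : K.Nonempty)
    (L : ℝ → (E →L[ℝ] ℝ)) (L' : E →L[ℝ] ℝ)
    (hL : HasDerivWithinAt L L' (Set.Ici (0:ℝ)) 0) :
    HasDerivWithinAt (fun t => sSup (L t '' K))
      (sSup (L' '' {H | H ∈ K ∧ L 0 H = sSup (L 0 '' K)})) (Set.Ici (0:ℝ)) 0 := by
  set g : ℝ → ℝ := fun t => sSup (L t '' K) with hg
  have hmax : ∀ t, ∃ H ∈ K, g t = L t H ∧ ∀ y ∈ K, L t y ≤ g t := by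
    intro t
    obtain ⟨x, hx, h1, h2⟩ := hK.exists_sSup_image_eq_and_ge hne (L t).continuous.continuousOn
    exact ⟨x, hx, h1, fun y hy => (h2 y hy).trans_eq h1.symm⟩
  set M : Set E := {H | H ∈ K ∧ L 0 H = g 0} with hM
  have hMc : IsCompact M := by
    have : M = K ∩ (L 0) ⁻¹' {g 0} := by ext; simp [hM]
    rw [this]
    exact hK.inter_right (isClosed_singleton.preimage (L 0).continuous)
  have hMne : M.Nonempty := by
    obtain ⟨x, hx, h1, _⟩ := hmax 0
    exact ⟨x, hx, h1.symm⟩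
  obtain ⟨z, hz, hz1, hz2⟩ := hMc.exists_sSup_image_eq_and_ge hMne L'.continuous.continuousOn
  set d := sSup (L' '' M) with hd
  obtain ⟨R, hR0, hR⟩ := hK.isBounded.exists_pos_norm_le
  -- uniform remainder
  have hrem : ∀ c > 0, ∀ᶠ t in 𝓝[Set.Ici (0:ℝ)] 0, ∀ H ∈ K,
      |L t H - L 0 H - t * L' H| ≤ c * t := by
    intro c hc
    have h := (hasDerivWithinAt_iff_isLittleO.1 hL).def (div_pos hc hR0)
    filter_upwards [h, self_mem_nhdsWithin] with t ht ht0 H hH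
    have ht0 : 0 ≤ t := ht0
    have h1 := (L t - L 0 - (t - 0) • L').le_opNorm H
    have h2 : ‖L t - L 0 - (t - 0) • L'‖ * ‖H‖ ≤ (c / R * t) * R := by
      rw [sub_zero, Real.norm_of_nonneg ht0] at ht
      rw [sub_zero]
      exact mul_le_mul ht (hR H hH) (norm_nonneg _) (by positivity)
    have h3 : (c / R * t) * R = c * t := by field_simp
    have := h1.trans (h2.trans_eq h3)
    simpa [Real.norm_eq_abs] using this
  have hcont : Tendsto L (𝓝[Set.Ici (0:ℝ)] 0) (𝓝 (L 0)) := hL.continuousWithinAt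
  rw [hasDerivWithinAt_iff_isLittleO, Asymptotics.isLittleO_iff]
  intro c hc
  have key : ∀ x ∈ K, ∀ᶠ p : ℝ × E in 𝓝[Set.Ici (0:ℝ)] 0 ×ˢ 𝓝 x,
      p.2 ∈ K → L p.1 p.2 ≤ g 0 + p.1 * (d + c) := by
    intro x hx
    by_cases hxM : L 0 x = g 0
    · have hxd : L' x ≤ d := hz1 ▸ hz2 x ⟨hx, hxM⟩
      have e1 : ∀ᶠ H in 𝓝 x, L' H < d + c / 2 :=
        L'.continuous.continuousAt.eventually (gt_mem_nhds (by linarith))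
      filter_upwards [((hrem (c/2) (by linarith)).and self_mem_nhdsWithin).prod_mk e1] with p hp hpK
      obtain ⟨⟨h1, h2⟩, h3⟩ := hp
      have h2 : 0 ≤ p.1 := h2
      have h4 := (abs_le.1 (h1 _ hpK)).2
      obtain ⟨y, hy, hy1, hy2⟩ := hmax 0
      have h5 := hy2 _ hpK
      nlinarith
    · have hlt : L 0 x < g 0 := by
        obtain ⟨y, hy, hy1, hy2⟩ := hmax 0
        exact lt_of_le_of_ne (hy2 x hx) hxM
      have t1 : Tendsto (fun p : ℝ × E => L p.1 p.2) (𝓝[Set.Ici (0:ℝ)] 0 ×ˢ 𝓝 x) (𝓝 (L 0 x)) :=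
        (isBoundedBilinearMap_apply (𝕜 := ℝ) (E := E) (F := ℝ)).continuous.continuousAt.tendsto.comp
          ((hcont.comp tendsto_fst).prodMk_nhds tendsto_snd)
      have t0 : Tendsto (fun p : ℝ × E => p.1) (𝓝[Set.Ici (0:ℝ)] 0 ×ˢ 𝓝 x) (𝓝 0) :=
        (tendsto_nhdsWithin_of_tendsto_nhds tendsto_id).comp tendsto_fst
      have t2 : Tendsto (fun p : ℝ × E => g 0 + p.1 * (d + c)) (𝓝[Set.Ici (0:ℝ)] 0 ×ˢ 𝓝 x)
          (𝓝 (g 0 + 0 * (d + c))) := (t0.mul_const _).const_add _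
      have := t1.eventually_lt t2 (by simpa using hlt)
      filter_upwards [this] with p hp _ using hp.le
  have up : ∀ᶠ t in 𝓝[Set.Ici (0:ℝ)] 0, ∀ H ∈ K, L t H ≤ g 0 + t * (d + c) := by
    have h := hK.mem_prod_nhdsSet_of_forall key
    have h' := Filter.Eventually.curry (h : ∀ᶠ p : ℝ × E in _, p.2 ∈ K → L p.1 p.2 ≤ g 0 + p.1 * (d + c))
    exact h'.mono fun t ht H hH => ht.self_of_nhdsSet H hH hH
  filter_upwards [up, hrem c hc, self_mem_nhdsWithin] with t h1 h2 h3
  have h3 : 0 ≤ t := h3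
  obtain ⟨y, hy, hy1, hy2⟩ := hmax t
  have a1 := h1 y hy
  have a2 := hy2 z hz.1
  have a3 := (abs_le.1 (h2 z hz.1)).1
  have a4 : L 0 z = g 0 := hz.2
  rw [sub_zero, Real.norm_of_nonneg h3, Real.norm_eq_abs, smul_eq_mul, abs_le]
  constructor
  · rw [hz1]; nlinarith
  · nlinarith
theorem danskin_bilin {E : Type*} [NormedAddCommGroup E] [NormedSpace ℝ E] [FiniteDimensional ℝ E]
    (K : Set E) (hK : IsCompact K) (hne : K.Nonempty) (B : E → E → ℝ)
    (hadd1 : ∀ x y z, B (x + y) z = B x z + B y z) (hsm1 : ∀ (c : ℝ) x z, B (c • x) z = c * B x z)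
    (hadd2 : ∀ x y z, B x (y + z) = B x y + B x z) (hsm2 : ∀ (c : ℝ) x z, B x (c • z) = c * B x z)
    (ρ : ℝ → E) (ρ' σ : E) (hρ : HasDerivWithinAt ρ ρ' (Set.Ici (0:ℝ)) 0) :
    HasDerivWithinAt (fun t => sSup (B (ρ t - σ) '' K))
      (sSup (B ρ' '' {H | H ∈ K ∧ B (ρ 0 - σ) H = sSup (B (ρ 0 - σ) '' K)}))
      (Set.Ici (0:ℝ)) 0 := by
  let P : E →ₗ[ℝ] (E →L[ℝ] ℝ) :=
    { toFun := fun A => LinearMap.toContinuousLinearMap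
        { toFun := fun H => B A H
          map_add' := fun X Y => hadd2 A X Y
          map_smul' := fun c X => hsm2 c A X }
      map_add' := fun X Y => ContinuousLinearMap.ext fun Z => hadd1 X Y Z
      map_smul' := fun c X => ContinuousLinearMap.ext fun Z => hsm1 c X Z }
  let F : E →L[ℝ] (E →L[ℝ] ℝ) := LinearMap.toContinuousLinearMap P
  have hL : HasDerivWithinAt (fun t => F (ρ t - σ)) (F ρ') (Set.Ici (0:ℝ)) 0 :=
    F.hasFDerivAt.comp_hasDerivWithinAt (0:ℝ) (hρ.sub_const σ)
  exact danskin_abs K hK hne _ _ hL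
end danskinAbstract

section emCompact
open scoped Matrix.Norms.L2Operator

theorem opNorm_eq_norm {n : ℕ} {X : QMat n} (h : X.IsHermitian) : opNorm X = ‖X‖ := by
  rw [opNorm, dif_pos h]
  conv_rhs => rw [h.spectral_theorem]
  simp only [Unitary.conjStarAlgAut_apply]
  rw [CStarRing.norm_mul_mem_unitary _ (by simp), CStarRing.norm_coe_unitary_mul,
    Matrix.l2_opNorm_diagonal]
  apply le_antisymm
  · refine Real.iSup_le (fun i => ?_) (norm_nonneg _)
    simpa using norm_le_pi_norm (RCLike.ofReal ∘ h.eigenvalues : _ → ℂ) i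
  · refine (pi_norm_le_iff_of_nonneg (Real.iSup_nonneg fun i => abs_nonneg _)).2 fun i => ?_
    simpa using le_ciSup (f := fun i => |h.eigenvalues i|) (Set.finite_range _).bddAbove i

theorem actsIdOn_zero {n : ℕ} (i : Fin n) : actsIdOn i (0 : QMat n) := by
  intro a b; simp

theorem actsIdOn_add_smul {n : ℕ} (i : Fin n) (K : QMat n) (hK : actsIdOn i K) (c : ℝ) :
    actsIdOn i (K + (c : ℂ) • (1 : QMat n)) := by
  intro a b
  rw [Matrix.add_apply, hK a b]
  by_cases h : a i = b i
  · have : a = b ↔ Function.update a i 0 = Function.update b i 0 := by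
      constructor
      · rintro rfl; rfl
      · intro e
        funext j
        by_cases hj : j = i
        · subst hj; exact h
        · simpa [hj] using congrFun e j
    simp [h, Matrix.one_apply, this]
  · have : a ≠ b := fun e => h (by rw [e])
    simp [h, this]

theorem lip_iff {n : ℕ} {H : QMat n} (hH : H.IsHermitian) :
    lipConst H ≤ 1 ↔ ∀ i : Fin n, ∀ ε > 0, ∃ K : QMat n, K.IsHermitian ∧ actsIdOn i K ∧
      ‖H - K‖ < 1 / 2 + ε := by
  have hbdd : ∀ i : Fin n, BddBelow
      { r | ∃ K : QMat n, K.IsHermitian ∧ actsIdOn i K ∧ r = opNorm (H - K) } := by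
    intro i
    refine ⟨0, ?_⟩
    rintro r ⟨K, hK, -, rfl⟩
    rw [opNorm_eq_norm (hH.sub hK)]
    exact norm_nonneg _
  constructor
  · intro h i ε hε
    have h1 : sInf { r | ∃ K : QMat n, K.IsHermitian ∧ actsIdOn i K ∧ r = opNorm (H - K) }
        ≤ 1 / 2 := by
      have := le_ciSup (f := fun i : Fin n =>
        sInf { r | ∃ K : QMat n, K.IsHermitian ∧ actsIdOn i K ∧ r = opNorm (H - K) })
        (Set.finite_range _).bddAbove i
      unfold lipConst at h
      linarith
    obtain ⟨r, ⟨K, hK, hK1, rfl⟩, hr⟩ := exists_lt_of_csInf_lt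
      (s := { r | ∃ K : QMat n, K.IsHermitian ∧ actsIdOn i K ∧ r = opNorm (H - K) })
      ⟨_, 0, Matrix.isHermitian_zero, actsIdOn_zero i, rfl⟩
      (lt_of_le_of_lt h1 (by linarith : (1:ℝ) / 2 < 1 / 2 + ε))
    rw [opNorm_eq_norm (hH.sub hK)] at hr
    exact ⟨K, hK, hK1, hr⟩
  · intro h
    have : (⨆ i : Fin n,
        sInf { r | ∃ K : QMat n, K.IsHermitian ∧ actsIdOn i K ∧ r = opNorm (H - K) }) ≤ 1 / 2 := by
      refine Real.iSup_le (fun i => ?_) (by norm_num)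
      refine le_of_forall_pos_le_add fun ε hε => ?_
      obtain ⟨K, hK, hK1, hK2⟩ := h i ε hε
      rw [← opNorm_eq_norm (hH.sub hK)] at hK2
      exact (csInf_le (hbdd i) ⟨K, hK, hK1, rfl⟩).trans hK2.le
    unfold lipConst
    linarith

theorem herm_smul_one {n : ℕ} (c : ℝ) : ((c : ℂ) • (1 : QMat n)).IsHermitian := by
  simp [Matrix.IsHermitian, Matrix.conjTranspose_smul]

theorem lip_shift {n : ℕ} {H : QMat n} (hH : H.IsHermitian) (c : ℝ) (h : lipConst H ≤ 1) :
    lipConst (H + (c : ℂ) • (1 : QMat n)) ≤ 1 := by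
  rw [lip_iff (hH.add (herm_smul_one c))]
  intro i ε hε
  obtain ⟨K, hK, hK1, hK2⟩ := (lip_iff hH).1 h i ε hε
  refine ⟨K + (c : ℂ) • (1 : QMat n), hK.add (herm_smul_one c), actsIdOn_add_smul i K hK1 c, ?_⟩
  rwa [add_sub_add_right_eq_sub]

/-- The compact feasible set. -/
def feas (n : ℕ) : Set (QMat n) := {H | H.IsHermitian ∧ lipConst H ≤ 1 ∧ H.trace = 0}

theorem feas_nonempty (n : ℕ) : (feas n).Nonempty := by
  refine ⟨0, Matrix.isHermitian_zero, ?_, by simp⟩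
  rw [lip_iff Matrix.isHermitian_zero]
  intro i ε hε
  exact ⟨0, Matrix.isHermitian_zero, actsIdOn_zero i, by simp; linarith⟩

theorem feas_closed (n : ℕ) : IsClosed (feas n) := by
  refine isClosed_of_closure_subset fun H hH => ?_
  have h1 : H.IsHermitian := by
    have hc : IsClosed {H : QMat n | H.IsHermitian} :=
      isClosed_eq (by fun_prop) continuous_id
    exact closure_minimal (fun X hX => hX.1) hc hH
  have h2 : H.trace = 0 := by
    have hc : IsClosed {H : QMat n | H.trace = 0} :=
      isClosed_eq (by fun_prop) continuous_const
    exact closure_minimal (fun X hX => hX.2.2) hc hH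
  refine ⟨h1, ?_, h2⟩
  rw [lip_iff h1]
  intro i ε hε
  obtain ⟨X, hX, hd⟩ := Metric.mem_closure_iff.1 hH (ε / 2) (by linarith)
  obtain ⟨K, hK, hK1, hK2⟩ := (lip_iff hX.1).1 hX.2.1 i (ε / 2) (by linarith)
  refine ⟨K, hK, hK1, ?_⟩
  rw [dist_eq_norm] at hd
  have := norm_add_le (H - X) (X - K)
  rw [sub_add_sub_cancel] at this
  linarith

theorem entry_bound (n : ℕ) : ∃ C : ℝ, 0 < C ∧ ∀ (X : QMat n) a b, ‖X a b‖ ≤ C * ‖X‖ := by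
  let f : QMat n →ₗ[ℂ] ((Fin n → Fin 2) → (Fin n → Fin 2) → ℂ) :=
    { toFun := fun X => X, map_add' := fun _ _ => rfl, map_smul' := fun _ _ => rfl }
  let F := LinearMap.toContinuousLinearMap f
  refine ⟨‖F‖ + 1, by positivity, fun X a b => ?_⟩
  have h1 : ‖F X a b‖ ≤ ‖F X‖ := (norm_le_pi_norm (F X a) b).trans (norm_le_pi_norm (F X) a)
  have h2 := F.le_opNorm X
  have h3 : F X a b = X a b := rfl
  rw [h3] at h1
  have := norm_nonneg X
  nlinarith

theorem bound_entry (n : ℕ) : ∃ C : ℝ, 0 < C ∧ ∀ (X : QMat n) (r : ℝ), 0 ≤ r →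
    (∀ a b, ‖X a b‖ ≤ r) → ‖X‖ ≤ C * r := by
  let f : ((Fin n → Fin 2) → (Fin n → Fin 2) → ℂ) →ₗ[ℂ] QMat n :=
    { toFun := fun X => X, map_add' := fun _ _ => rfl, map_smul' := fun _ _ => rfl }
  let F := LinearMap.toContinuousLinearMap f
  refine ⟨‖F‖ + 1, by positivity, fun X r hr hX => ?_⟩
  let Y : (Fin n → Fin 2) → (Fin n → Fin 2) → ℂ := X
  have h1 : ‖Y‖ ≤ r := (pi_norm_le_iff_of_nonneg hr).2 fun a =>
    (pi_norm_le_iff_of_nonneg hr).2 fun b => hX a b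
  have h2 := F.le_opNorm Y
  have h3 : F Y = X := rfl
  rw [h3] at h2
  have := norm_nonneg F
  nlinarith [norm_nonneg Y]

theorem feas_bounded (n : ℕ) : Bornology.IsBounded (feas n) := by
  obtain ⟨C, hC, hCe⟩ := entry_bound n
  obtain ⟨D, hD, hDe⟩ := bound_entry n
  rw [isBounded_iff_forall_norm_le]
  refine ⟨D * (C + 4 * C * n), fun H hH => hDe H _ (by positivity) ?_⟩
  have hK : ∀ i : Fin n, ∃ K : QMat n, actsIdOn i K ∧ ∀ a b, ‖H a b - K a b‖ ≤ C := by
    intro i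
    obtain ⟨K, -, hK1, hK2⟩ := (lip_iff hH.1).1 hH.2.1 i (1 / 2) (by norm_num)
    refine ⟨K, hK1, fun a b => (hCe (H - K) a b).trans ?_⟩
    nlinarith
  -- diagonal steps
  have hstep : ∀ (i : Fin n) (a : Fin n → Fin 2),
      ‖H a a - H (Function.update a i 0) (Function.update a i 0)‖ ≤ 2 * C := by
    intro i a
    obtain ⟨K, hK1, hK2⟩ := hK i
    have e := hK1 a a
    simp only [if_true] at e
    have h1 := hK2 a a
    have h2 := hK2 (Function.update a i 0) (Function.update a i 0)
    rw [← e] at h2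
    have h3 := norm_sub_le (H a a - K a a)
      (H (Function.update a i 0) (Function.update a i 0) - K a a)
    rw [sub_sub_sub_cancel_right] at h3
    linarith
  have hdiag : ∀ (s : Finset (Fin n)) (a : Fin n → Fin 2), (∀ i ∉ s, a i = 0) →
      ‖H a a - H 0 0‖ ≤ 2 * C * s.card := by
    intro s
    induction s using Finset.induction_on with
    | empty =>
      intro a ha
      have : a = 0 := funext fun i => ha i (by simp)
      simp [this]
    | insert i s his ih =>
      intro a ha
      have h1 := ih (Function.update a i 0) (fun j hj => by
        by_cases hji : j = i
        · subst hji; simp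
        · rw [Function.update_of_ne hji]
          exact ha j (by simp [hji, hj]))
      have h2 := hstep i a
      have h3 := norm_add_le (H a a - H (Function.update a i 0) (Function.update a i 0))
        (H (Function.update a i 0) (Function.update a i 0) - H 0 0)
      rw [sub_add_sub_cancel] at h3
      rw [Finset.card_insert_of_notMem his]
      push_cast
      linarith
  have hdiag' : ∀ a, ‖H a a - H 0 0‖ ≤ 2 * C * n := by
    intro a
    simpa using hdiag Finset.univ a (by simp)
  have h00 : ‖H 0 0‖ ≤ 2 * C * n := by
    set N : ℕ := Fintype.card (Fin n → Fin 2) with hN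
    have hNpos : (0 : ℝ) < N := by exact_mod_cast Fintype.card_pos
    have h1 : ∑ a, (H a a - H 0 0) = - ((N : ℂ) * H 0 0) := by
      have : ∑ a, H a a = 0 := hH.2.2
      rw [Finset.sum_sub_distrib, this]
      simp [hN]
    have h2 : ‖∑ a, (H a a - H 0 0)‖ ≤ N * (2 * C * n) := by
      refine (norm_sum_le_of_le _ (fun a _ => hdiag' a)).trans_eq ?_
      simp [hN]
    rw [h1, norm_neg, norm_mul, Complex.norm_natCast] at h2
    exact le_of_mul_le_mul_left h2 hNpos
  intro a b
  have hp : 0 ≤ C * n := by positivity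
  by_cases hab : a = b
  · subst hab
    have h3 := norm_add_le (H a a - H 0 0) (H 0 0)
    rw [sub_add_cancel] at h3
    linarith [hdiag' a]
  · obtain ⟨i, hi⟩ := Function.ne_iff.1 hab
    obtain ⟨K, hK1, hK2⟩ := hK i
    have e := hK1 a b
    rw [if_neg hi] at e
    have := hK2 a b
    rw [e, sub_zero] at this
    linarith

theorem feas_compact (n : ℕ) : IsCompact (feas n) :=
  haveI : ProperSpace (QMat n) := FiniteDimensional.proper ℂ _
  Metric.isCompact_of_isClosed_isBounded (feas_closed n) (feas_bounded n)

/-- The trace pairing. -/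
noncomputable def trPair (n : ℕ) (A H : QMat n) : ℝ := ((A * H).trace).re

theorem trPair_apply (n : ℕ) (A H : QMat n) : trPair n A H = ((A * H).trace).re := rfl

/-- Tracelessness lets us shift to the compact set. -/
theorem exists_feas {n : ℕ} (H : QMat n) (hH : H.IsHermitian) (hl : lipConst H ≤ 1) :
    ∃ X ∈ feas n, ∀ A : QMat n, A.trace = 0 → trPair n A X = trPair n A H := by
  set N : ℕ := Fintype.card (Fin n → Fin 2) with hN
  have hNpos : (N : ℂ) ≠ 0 := by exact_mod_cast Fintype.card_ne_zero
  have him : ((H.trace.re : ℝ) : ℂ) = H.trace := by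
    have : star H.trace = H.trace := by rw [← Matrix.trace_conjTranspose, hH.eq]
    exact Complex.conj_eq_iff_re.1 this
  refine ⟨H + ((-(H.trace.re / N) : ℝ) : ℂ) • (1 : QMat n),
    ⟨hH.add (herm_smul_one _), lip_shift hH _ hl, ?_⟩, fun A hA => ?_⟩
  · rw [Matrix.trace_add, Matrix.trace_smul, Matrix.trace_one, ← hN]
    push_cast
    rw [him]
    simp only [smul_eq_mul]
    field_simp
    ring
  · simp [trPair_apply, mul_add, hA]

theorem emDist_eq {n : ℕ} {ρ σ : QMat n} (h : (ρ - σ).trace = 0) :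
    emDistDual ρ σ = sSup (trPair n (ρ - σ) '' feas n) := by
  unfold emDistDual
  congr 1
  ext r
  constructor
  · rintro ⟨H, hH, hl, rfl⟩
    obtain ⟨X, hX, hX2⟩ := exists_feas H hH hl
    exact ⟨X, hX, hX2 _ h⟩
  · rintro ⟨X, hX, rfl⟩
    exact ⟨X, hX.1, hX.2.1, rfl⟩

theorem hasDeriv_mat {n : ℕ} (ρ : ℝ → QMat n) (ρ' : QMat n) (s : Set ℝ) (x : ℝ)
    (hdiff : ∀ a b, HasDerivWithinAt (fun t => ρ t a b) (ρ' a b) s x) :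
    HasDerivWithinAt ρ ρ' s x := by
  have e : ∀ A : QMat n, A = ∑ a, ∑ b, A a b • Matrix.single a b (1 : ℂ) := by
    intro A
    conv_lhs => rw [Matrix.matrix_eq_sum_single A]
    simp [Matrix.smul_single]
  have : HasDerivWithinAt (fun t => ∑ a, ∑ b, ρ t a b • (Matrix.single a b (1 : ℂ) : QMat n))
      (∑ a, ∑ b, ρ' a b • (Matrix.single a b (1 : ℂ) : QMat n)) s x :=
    HasDerivWithinAt.fun_sum fun a _ => HasDerivWithinAt.fun_sum fun b _ =>
      (hdiff a b).smul_const _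
  rw [← e] at this
  simpa only [← e] using this

theorem danskin_main (n : ℕ) (σ : QMat n) (hσ : IsState σ)
    (T : ℝ) (hT : 0 < T) (ρ : ℝ → QMat n)
    (hρ : ∀ t ∈ Set.Icc (0 : ℝ) T, IsState (ρ t))
    (ρ' : QMat n)
    (hdiff : ∀ a b : Fin n → Fin 2,
      HasDerivWithinAt (fun t => ρ t a b) (ρ' a b) (Set.Ici (0 : ℝ)) 0) :
    HasDerivWithinAt (fun t => emDistDual (ρ t) σ)
      (sSup { r | ∃ H : QMat n, H.IsHermitian ∧ lipConst H ≤ 1 ∧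
        (((ρ 0 - σ) * H).trace).re = emDistDual (ρ 0) σ ∧
        r = ((ρ' * H).trace).re })
      (Set.Ici (0 : ℝ)) 0 := by
  have htr : ∀ t ∈ Set.Icc (0 : ℝ) T, (ρ t - σ).trace = 0 := fun t ht => by
    rw [Matrix.trace_sub, (hρ t ht).2, hσ.2, sub_self]
  have h0 : (0 : ℝ) ∈ Set.Icc (0 : ℝ) T := ⟨le_rfl, hT.le⟩
  have hev : ∀ᶠ t in nhdsWithin (0 : ℝ) (Set.Ici 0), t ∈ Set.Icc (0 : ℝ) T :=
    Icc_mem_nhdsGE hT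
  have htr' : ρ'.trace = 0 := by
    have h1 : HasDerivWithinAt (fun t => (ρ t).trace) ρ'.trace (Set.Ici (0 : ℝ)) 0 :=
      HasDerivWithinAt.fun_sum fun a _ => hdiff a a
    have h2 : HasDerivWithinAt (fun t => (ρ t).trace) 0 (Set.Ici (0 : ℝ)) 0 := by
      refine (hasDerivWithinAt_const (0 : ℝ) (Set.Ici (0 : ℝ)) (1 : ℂ)).congr_of_eventuallyEq ?_
        (hρ 0 h0).2
      filter_upwards [hev] with t ht using (hρ t ht).2
    exact (uniqueDiffWithinAt_Ici (0 : ℝ)).eq_deriv _ h1 h2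
  have main := danskin_bilin (feas n) (feas_compact n) (feas_nonempty n) (trPair n)
    (fun x y z => by simp [trPair_apply, add_mul])
    (fun c x z => by
      have e : c • x = (c : ℂ) • x := rfl
      rw [e]; simp [trPair_apply])
    (fun x y z => by simp [trPair_apply, mul_add])
    (fun c x z => by
      have e : c • z = (c : ℂ) • z := rfl
      rw [e]; simp [trPair_apply])
    ρ ρ' σ (hasDeriv_mat ρ ρ' _ _ hdiff)
  have hset : { r | ∃ H : QMat n, H.IsHermitian ∧ lipConst H ≤ 1 ∧
        (((ρ 0 - σ) * H).trace).re = emDistDual (ρ 0) σ ∧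
        r = ((ρ' * H).trace).re } =
      trPair n ρ' '' {H | H ∈ feas n ∧
        trPair n (ρ 0 - σ) H = sSup (trPair n (ρ 0 - σ) '' feas n)} := by
    rw [emDist_eq (htr 0 h0)]
    ext r
    constructor
    · rintro ⟨H, hH, hl, h1, rfl⟩
      obtain ⟨X, hX, hX2⟩ := exists_feas H hH hl
      exact ⟨X, ⟨hX, (hX2 _ (htr 0 h0)).trans h1⟩, hX2 _ htr'⟩
    · rintro ⟨X, ⟨hX, h1⟩, rfl⟩
      exact ⟨X, hX.1, hX.2.1, h1, rfl⟩
  rw [hset]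
  refine main.congr_of_eventuallyEq ?_ (emDist_eq (htr 0 h0))
  filter_upwards [hev] with t ht using emDist_eq (htr t ht)
end emCompact

/-- Danskin-type derivative of the EM distance: for a family of states `ρ(t)`, `0 ≤ t ≤ T`,
differentiable at `t = 0` (entrywise, with derivative `ρ'`), the right derivative of
`t ↦ D_EM(ρ(t), σ)` at `0` equals
`max { Tr[ρ'(0) H] : ‖H‖_L ≤ 1, Tr[(ρ(0)−σ)H] = D_EM(ρ(0),σ) }`. -/
theorem emDist_danskin_derivative (n : ℕ) (σ : QMat n) (hσ : IsState σ)
    (T : ℝ) (hT : 0 < T) (ρ : ℝ → QMat n)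
    (hρ : ∀ t ∈ Set.Icc (0 : ℝ) T, IsState (ρ t))
    (ρ' : QMat n)
    (hdiff : ∀ a b : Fin n → Fin 2,
      HasDerivWithinAt (fun t => ρ t a b) (ρ' a b) (Set.Ici (0 : ℝ)) 0) :
    HasDerivWithinAt (fun t => emDistDual (ρ t) σ)
      (sSup { r | ∃ H : QMat n, H.IsHermitian ∧ lipConst H ≤ 1 ∧
        (((ρ 0 - σ) * H).trace).re = emDistDual (ρ 0) σ ∧
        r = ((ρ' * H).trace).re })
      (Set.Ici (0 : ℝ)) 0 := 
  danskin_main n σ hσ T hT ρ hρ ρ' hdiff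
end
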